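/- Let f be standard self-concordant on an open convex set dom f ⊆ ℝⁿ, g : ℝⁿ → ℝ ∪ {+∞} proper, lower semicontinuous and convex, F := f + g, and assume the unique minimizer x* of F satisfies ∇²f(x*) ≻ 0. Consider the proximal-Newton scheme x^{k+1} := x^k + α_k d^k with d^k := P^g_{∇²f(x^k)}(∇²f(x^k)x^k − ∇f(x^k)) − x^k, λ_k := ‖d^k‖_{x^k}, and α_k ∈ (0,1], the Hessians ∇²f(x^k) being positive definite. If α_k λ_k < 1 − 1/√2, then λ_{k+1} ≤ [ (1 − α_k + (2α_k² − α_k)λ_k) / (1 − 4α_k λ_k + 2α_k² λ_k²) ] · λ_k. -/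

import Mathlib

open Matrix Set Filter Topology

noncomputable section

variable {n : ℕ}

/-- Weighted (semi)norm induced by a matrix `H`: `‖z‖_H = √(zᵀ H z)`. -/
def mNorm (H : Matrix (Fin n) (Fin n) ℝ) (z : Fin n → ℝ) : ℝ :=
  Real.sqrt (z ⬝ᵥ H.mulVec z)

/-- Dual weighted norm, `‖z‖*_H = √(zᵀ H⁻¹ z)`. -/
def mDualNorm (H : Matrix (Fin n) (Fin n) ℝ) (z : Fin n → ℝ) : ℝ :=
  Real.sqrt (z ⬝ᵥ H⁻¹.mulVec z)

/-- A function `g : ℝⁿ → ℝ ∪ {+∞}` (modelled with values in `EReal`) is proper. -/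
def EProper (g : (Fin n → ℝ) → EReal) : Prop :=
  (∀ x, g x ≠ ⊥) ∧ ∃ x, g x ≠ ⊤

/-- Convexity of an `EReal`-valued function on `ℝⁿ`. -/
def EConvex (g : (Fin n → ℝ) → EReal) : Prop :=
  ∀ x y : Fin n → ℝ, ∀ a b : ℝ, 0 ≤ a → 0 ≤ b → a + b = 1 →
    g (a • x + b • y) ≤ (a : EReal) * g x + (b : EReal) * g y

/-- `v` is a subgradient of `g` at `x`. -/
def ESubgradAt (g : (Fin n → ℝ) → EReal) (v x : Fin n → ℝ) : Prop :=
  g x ≠ ⊤ ∧ ∀ y, g x + ((v ⬝ᵥ (y - x) : ℝ) : EReal) ≤ g y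

/-- Objective of the proximal subproblem `g(x) + ½ xᵀHx − uᵀx`. -/
def proxObj (H : Matrix (Fin n) (Fin n) ℝ) (g : (Fin n → ℝ) → EReal)
    (u x : Fin n → ℝ) : EReal :=
  g x + ((1 / 2 * (x ⬝ᵥ H.mulVec x) - u ⬝ᵥ x : ℝ) : EReal)

/-- `p` solves the proximal subproblem, i.e. `p = P^g_H(u)`. -/
def IsProxPt (H : Matrix (Fin n) (Fin n) ℝ) (g : (Fin n → ℝ) → EReal)
    (u p : Fin n → ℝ) : Prop :=
  ∀ x, proxObj H g u p ≤ proxObj H g u x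

/-- The continuous linear map `y ↦ vᵀy`. -/
def dotCLM (v : Fin n → ℝ) : (Fin n → ℝ) →L[ℝ] ℝ :=
  LinearMap.toContinuousLinearMap
    { toFun := fun y => v ⬝ᵥ y
      map_add' := fun a b => dotProduct_add v a b
      map_smul' := fun c a => by simp }

/-- `f` is standard self-concordant on the open convex set `D`. -/
def StdSelfConcordantOn (D : Set (Fin n → ℝ)) (f : (Fin n → ℝ) → ℝ) : Prop :=
  IsOpen D ∧ Convex ℝ D ∧ ConvexOn ℝ D f ∧ ContDiffOn ℝ 3 f D ∧
    ∀ x ∈ D, ∀ v : Fin n → ℝ, ∀ t : ℝ, x + t • v ∈ D →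
      |iteratedDeriv 3 (fun s : ℝ => f (x + s • v)) t| ≤
        2 * iteratedDeriv 2 (fun s : ℝ => f (x + s • v)) t ^ ((3 : ℝ) / 2)

open scoped Classical in
/-- The extended objective `F = f + g`, equal to `+∞` outside `dom f`. -/
def Fext (D : Set (Fin n → ℝ)) (f : (Fin n → ℝ) → ℝ) (g : (Fin n → ℝ) → EReal)
    (x : Fin n → ℝ) : EReal :=
  if x ∈ D then (f x : EReal) + g x else ⊤

def omega (t : ℝ) : ℝ := t - Real.log (1 + t)

def omegaStar (t : ℝ) : ℝ := -t - Real.log (1 - t)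

theorem abs_le_of_abs_cubic_le_on_circle {A B C D M : ℝ}
    (h : ∀ x y : ℝ, x ^ 2 + y ^ 2 = 1 →
      |A * x ^ 3 + 3 * B * x ^ 2 * y + 3 * C * x * y ^ 2 + D * y ^ 3| ≤ M)
    {x y : ℝ} (hxy : x ^ 2 + y ^ 2 = 1) : |A * x + B * y| ≤ M := by
  obtain ⟨φ, rfl, rfl⟩ : ∃ φ, x = Real.cos φ ∧ y = Real.sin φ := by
    have hn : ‖(⟨x, y⟩ : ℂ)‖ = 1 := by
      rw [Complex.norm_def, Complex.normSq_mk, Real.sqrt_eq_one]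
      linarith
    have h1 := Complex.norm_mul_cos_arg (⟨x, y⟩ : ℂ)
    have h2 := Complex.norm_mul_sin_arg (⟨x, y⟩ : ℂ)
    rw [hn, one_mul] at h1 h2
    exact ⟨_, h1.symm, h2.symm⟩
  obtain ⟨τ, rfl⟩ : ∃ τ, φ = 3 * τ := ⟨φ / 3, by ring⟩
  rw [Real.cos_three_mul, Real.sin_three_mul]
  have hcs := Real.cos_sq_add_sin_sq τ
  generalize Real.cos τ = c at *
  generalize Real.sin τ = s at *
  have hr : Real.sqrt 3 ^ 2 = 3 := Real.sq_sqrt (by norm_num)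
  generalize Real.sqrt 3 = r at *
  set p : ℝ → ℝ → ℝ := fun x y =>
    A * x ^ 3 + 3 * B * x ^ 2 * y + 3 * C * x * y ^ 2 + D * y ^ 3 with hp
  have h0 := abs_le.1 (h c s hcs)
  have h1 := abs_le.1 (h (c / 2 - r / 2 * s) (s / 2 + r / 2 * c) (by
    linear_combination (1 / 4 + r ^ 2 / 4) * hcs + hr / 4))
  have h2 := abs_le.1 (h (-c / 2 - r / 2 * s) (-s / 2 + r / 2 * c) (by
    linear_combination (1 / 4 + r ^ 2 / 4) * hcs + hr / 4))
  have hd : (4 * c ^ 2 - 1) ^ 2 + (4 * (c / 2 - r / 2 * s) ^ 2 - 1) ^ 2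
      + (4 * (-c / 2 - r / 2 * s) ^ 2 - 1) ^ 2 = 9 := by
    grind
  have key : 9 * (A * (4 * c ^ 3 - 3 * c) + B * (3 * s - 4 * s ^ 3)) =
      (4 * c ^ 2 - 1) ^ 2 * p c s
      - (4 * (c / 2 - r / 2 * s) ^ 2 - 1) ^ 2 * p (c / 2 - r / 2 * s) (s / 2 + r / 2 * c)
      + (4 * (-c / 2 - r / 2 * s) ^ 2 - 1) ^ 2 * p (-c / 2 - r / 2 * s) (-s / 2 + r / 2 * c) := by
    simp only [hp]
    grind
  change -M ≤ p _ _ ∧ p _ _ ≤ M at h0 h1 h2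
  generalize p c s = P0 at *
  generalize p _ _ = P1 at *
  generalize p _ _ = P2 at *
  have q0 := sq_nonneg (4 * c ^ 2 - 1)
  have q1 := sq_nonneg (4 * (c / 2 - r / 2 * s) ^ 2 - 1)
  have q2 := sq_nonneg (4 * (-c / 2 - r / 2 * s) ^ 2 - 1)
  generalize (4 * c ^ 2 - 1) ^ 2 = d0 at *
  generalize (4 * (c / 2 - r / 2 * s) ^ 2 - 1) ^ 2 = d1 at *
  generalize (4 * (-c / 2 - r / 2 * s) ^ 2 - 1) ^ 2 = d2 at *
  rw [abs_le]
  have e : M * 9 = M * d0 + M * d1 + M * d2 := by rw [← hd]; ring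
  constructor <;>
  nlinarith [mul_le_mul_of_nonneg_left h0.1 q0, mul_le_mul_of_nonneg_left h0.2 q0,
    mul_le_mul_of_nonneg_left h1.1 q1, mul_le_mul_of_nonneg_left h1.2 q1,
    mul_le_mul_of_nonneg_left h2.1 q2, mul_le_mul_of_nonneg_left h2.2 q2]

theorem abs_le_of_abs_cubic_le_posDef {A B C D M a b c : ℝ}
    (ha : 0 < a) (hdet : 0 < a * c - b ^ 2)
    (h : ∀ x y : ℝ, |A * x ^ 3 + 3 * B * x ^ 2 * y + 3 * C * x * y ^ 2 + D * y ^ 3| ≤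
      M * (a * x ^ 2 + 2 * b * x * y + c * y ^ 2) ^ ((3 : ℝ) / 2)) :
    |B| ≤ M * (a * Real.sqrt c) := by
  have hc : 0 < c := by
    by_contra! hc
    nlinarith [sq_nonneg b]
  obtain ⟨α, hα, rfl⟩ : ∃ α, 0 < α ∧ α ^ 2 = a := ⟨√a, Real.sqrt_pos.2 ha, Real.sq_sqrt ha.le⟩
  obtain ⟨γ, hγ, rfl⟩ : ∃ γ, 0 < γ ∧ γ ^ 2 = c := ⟨√c, Real.sqrt_pos.2 hc, Real.sq_sqrt hc.le⟩
  obtain ⟨r, hr, hr2⟩ : ∃ r, 0 < r ∧ r ^ 2 = γ ^ 2 - b ^ 2 / α ^ 2 := by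
    have : 0 < γ ^ 2 - b ^ 2 / α ^ 2 := by
      rw [sub_pos, div_lt_iff₀ ha]; linarith
    exact ⟨_, Real.sqrt_pos.2 this, Real.sq_sqrt this.le⟩
  rw [Real.sqrt_sq hγ.le]
  have hr3 : r ^ 2 * α ^ 2 = γ ^ 2 * α ^ 2 - b ^ 2 := by rw [hr2]; field_simp
  -- substitute coordinates that are orthonormal for the quadratic form
  have hq : ∀ X Y : ℝ, X ^ 2 + Y ^ 2 = 1 →
      α ^ 2 * (X / α - b / α ^ 2 * (Y / r)) ^ 2
        + 2 * b * (X / α - b / α ^ 2 * (Y / r)) * (Y / r) + γ ^ 2 * (Y / r) ^ 2 = 1 := by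
    intro X Y hXY
    have : α ^ 2 * (X / α - b / α ^ 2 * (Y / r)) ^ 2
        + 2 * b * (X / α - b / α ^ 2 * (Y / r)) * (Y / r) + γ ^ 2 * (Y / r) ^ 2
        = X ^ 2 + (γ ^ 2 - b ^ 2 / α ^ 2) * Y ^ 2 / r ^ 2 := by
      field_simp
      ring
    rw [this, ← hr2, ← hXY]
    field_simp
  have hk := abs_le_of_abs_cubic_le_on_circle (A := A / α ^ 3)
    (B := (B - b / α ^ 2 * A) / (α ^ 2 * r))
    (C := (C - 2 * (b / α ^ 2) * B + (b / α ^ 2) ^ 2 * A) / (α * r ^ 2))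
    (D := (D - 3 * (b / α ^ 2) * C + 3 * (b / α ^ 2) ^ 2 * B - (b / α ^ 2) ^ 3 * A) / r ^ 3)
    (M := M) (fun X Y hXY => by
      have := h (X / α - b / α ^ 2 * (Y / r)) (Y / r)
      rw [hq X Y hXY, Real.one_rpow, mul_one] at this
      refine le_of_eq_of_le ?_ this
      congr 1
      field_simp
      ring) (x := b / (α * γ)) (y := r / γ) (by
      field_simp
      linarith)
  have e : A / α ^ 3 * (b / (α * γ)) + (B - b / α ^ 2 * A) / (α ^ 2 * r) * (r / γ)
      = B / (α ^ 2 * γ) := by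
    field_simp
    ring
  rwa [e, abs_div, abs_of_pos (by positivity : 0 < α ^ 2 * γ), div_le_iff₀ (by positivity)] at hk

theorem abs_le_of_abs_cubic_le_posSemidef {A B C D M a b c : ℝ} (hM : 0 ≤ M)
    (hq : ∀ x y : ℝ, 0 ≤ a * x ^ 2 + 2 * b * x * y + c * y ^ 2)
    (h : ∀ x y : ℝ, |A * x ^ 3 + 3 * B * x ^ 2 * y + 3 * C * x * y ^ 2 + D * y ^ 3| ≤
      M * (a * x ^ 2 + 2 * b * x * y + c * y ^ 2) ^ ((3 : ℝ) / 2)) :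
    |B| ≤ M * (a * Real.sqrt c) := by
  have ha : 0 ≤ a := by simpa using hq 1 0
  have hc : 0 ≤ c := by simpa using hq 0 1
  have hdet : b ^ 2 ≤ a * c := by
    have := discrim_le_zero (a := a) (b := 2 * b) (c := c) fun x => by
      linarith [hq x 1]
    rw [discrim] at this
    linarith
  have hε : ∀ ε > 0, |B| ≤ M * ((a + ε) * Real.sqrt (c + ε)) := fun ε hε =>
    abs_le_of_abs_cubic_le_posDef (A := A) (C := C) (D := D) (b := b) (by positivity)
      (by nlinarith [mul_nonneg ha hε.le, mul_nonneg hc hε.le, mul_pos hε hε]) fun x y => by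
        refine (h x y).trans ?_
        gcongr
        · exact hq x y
        · linarith
        · linarith
  have ht : Tendsto (fun ε : ℝ => M * ((a + ε) * Real.sqrt (c + ε))) (𝓝[>] 0)
      (𝓝 (M * ((a + 0) * Real.sqrt (c + 0)))) :=
    (Continuous.tendsto (by fun_prop) 0).mono_left nhdsWithin_le_nhds
  rw [add_zero, add_zero] at ht
  exact ge_of_tendsto ht (eventually_nhdsWithin_of_forall hε)

theorem abs_bilin_le_of_abs_quad_le {E : Type*} [NormedAddCommGroup E] [NormedSpace ℝ E]
    {A B : E →L[ℝ] E →L[ℝ] ℝ} (hA : ∀ u v, A u v = A v u) (hB : ∀ u v, B u v = B v u)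
    {κ : ℝ} (hκ : 0 ≤ κ) (hpos : ∀ v, 0 ≤ B v v)
    (h : ∀ v, |A v v| ≤ κ * B v v) (u v : E) :
    |A u v| ≤ κ * (√(B u u) * √(B v v)) := by
  have hd := discrim_le_zero (a := 2 * κ * B v v) (b := -(4 * A u v)) (c := 2 * κ * B u u)
    fun t => by
      have h1 := (abs_le.1 (h (u + t • v))).2
      have h2 := (abs_le.1 (h (u - t • v))).1
      simp only [map_add, map_sub, map_smul, _root_.add_apply, _root_.sub_apply,
        _root_.smul_apply, smul_eq_mul, hA v u, hB v u] at h1 h2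
      linarith
  rw [discrim] at hd
  rw [← Real.sqrt_mul (hpos u)]
  apply abs_le_of_sq_le_sq
  · rw [mul_pow, Real.sq_sqrt (mul_nonneg (hpos u) (hpos v))]
    linarith
  · positivity

theorem Real.rpow_three_halves {x : ℝ} (hx : 0 ≤ x) : x ^ ((3 : ℝ) / 2) = x * √x := by
  rw [show (3 : ℝ) / 2 = 1 + 1 / 2 by norm_num, Real.rpow_add_of_nonneg hx (by norm_num)
    (by norm_num), Real.rpow_one, Real.sqrt_eq_rpow]

theorem le_of_hasDerivAt_nonneg_unitInterval {F F' : ℝ → ℝ}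
    (hF : ∀ t ∈ Icc (0 : ℝ) 1, HasDerivAt F (F' t) t) (hF' : ∀ t ∈ Icc (0 : ℝ) 1, 0 ≤ F' t)
    {t : ℝ} (ht : t ∈ Icc (0 : ℝ) 1) : F 0 ≤ F t :=
  monotoneOn_of_hasDerivWithinAt_nonneg (convex_Icc 0 1)
    (fun s hs => (hF s hs).continuousAt.continuousWithinAt)
    (fun s hs => (hF s (interior_subset hs)).hasDerivWithinAt)
    (fun s hs => hF' s (interior_subset hs)) (left_mem_Icc.2 zero_le_one) ht ht.1

theorem sqrt_le_of_abs_deriv_le_rpow {ψ ψ' : ℝ → ℝ}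
    (hψ : ∀ t ∈ Icc (0 : ℝ) 1, HasDerivAt ψ (ψ' t) t) (hpos : ∀ t ∈ Icc (0 : ℝ) 1, 0 ≤ ψ t)
    (hψ' : ∀ t ∈ Icc (0 : ℝ) 1, |ψ' t| ≤ 2 * ψ t ^ ((3 : ℝ) / 2))
    {t : ℝ} (ht : t ∈ Icc (0 : ℝ) 1) : (1 - t * √(ψ 0)) * √(ψ t) ≤ √(ψ 0) := by
  have hε : ∀ ε > 0, (1 - t * √(ψ 0 + ε)) * √(ψ t + ε) ≤ √(ψ 0 + ε) := by
    intro ε hε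
    have key := le_of_hasDerivAt_nonneg_unitInterval (F := fun s => s + (√(ψ s + ε))⁻¹)
      (F' := fun s => 1 + -(ψ' s / (2 * √(ψ s + ε))) / √(ψ s + ε) ^ 2)
      (fun s hs => by
        have h0 : 0 < ψ s + ε := by linarith [hpos s hs]
        exact (hasDerivAt_id s).add
          ((((hψ s hs).add_const ε).sqrt h0.ne').fun_inv (Real.sqrt_pos.2 h0).ne'))
      (fun s hs => by
        have h0 : 0 < ψ s + ε := by linarith [hpos s hs]
        have h1 : |ψ' s| ≤ 2 * (√(ψ s + ε) ^ 2 * √(ψ s + ε)) := by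
          rw [Real.sq_sqrt h0.le, ← Real.rpow_three_halves h0.le]
          refine (hψ' s hs).trans ?_
          gcongr
          · exact hpos s hs
          · linarith
        have h2 := (abs_le.1 h1).2
        have h3 := Real.sqrt_pos.2 h0
        have h4 : ψ' s / (2 * √(ψ s + ε)) / √(ψ s + ε) ^ 2 ≤ 1 := by
          rw [div_div, div_le_one (by positivity)]
          linarith
        rw [neg_div]
        linarith) ht
    have h0 : 0 < √(ψ 0 + ε) :=
      Real.sqrt_pos.2 (by linarith [hpos 0 (left_mem_Icc.2 zero_le_one)])
    have h1 : 0 < √(ψ t + ε) := Real.sqrt_pos.2 (by linarith [hpos t ht])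
    simp only [zero_add] at key
    have := mul_le_mul_of_nonneg_right key (mul_pos h0 h1).le
    field_simp at this
    linarith
  have hl : Tendsto (fun ε : ℝ => (1 - t * √(ψ 0 + ε)) * √(ψ t + ε)) (𝓝[>] 0)
      (𝓝 ((1 - t * √(ψ 0 + 0)) * √(ψ t + 0))) :=
    (Continuous.tendsto (by fun_prop) 0).mono_left nhdsWithin_le_nhds
  have hr : Tendsto (fun ε : ℝ => √(ψ 0 + ε)) (𝓝[>] 0) (𝓝 (√(ψ 0 + 0))) :=
    (Continuous.tendsto (by fun_prop) 0).mono_left nhdsWithin_le_nhds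
  simpa using le_of_tendsto_of_tendsto hl hr (eventually_nhdsWithin_of_forall hε)

theorem bounds_of_abs_deriv_le_mul {φ φ' ρ : ℝ → ℝ} {s : ℝ} (hs0 : 0 ≤ s) (hs1 : s < 1)
    (hφ : ∀ t ∈ Icc (0 : ℝ) 1, HasDerivAt φ (φ' t) t) (hpos : ∀ t ∈ Icc (0 : ℝ) 1, 0 ≤ φ t)
    (hρ : ∀ t ∈ Icc (0 : ℝ) 1, (1 - t * s) * ρ t ≤ s)
    (hφ' : ∀ t ∈ Icc (0 : ℝ) 1, |φ' t| ≤ 2 * (φ t * ρ t))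
    {t : ℝ} (ht : t ∈ Icc (0 : ℝ) 1) :
    (1 - t * s) ^ 2 * φ 0 ≤ φ t ∧ (1 - t * s) ^ 2 * φ t ≤ φ 0 := by
  have h1 : ∀ t ∈ Icc (0 : ℝ) 1, 0 < 1 - t * s := fun t ht => by nlinarith [ht.1, ht.2]
  have hb : ∀ t ∈ Icc (0 : ℝ) 1, (1 - t * s) * |φ' t| ≤ 2 * s * φ t := fun t ht => by
    nlinarith [mul_le_mul_of_nonneg_left (hφ' t ht) (h1 t ht).le,
      mul_le_mul_of_nonneg_left (hρ t ht) (hpos t ht)]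
  have hd : ∀ t : ℝ, HasDerivAt (fun t => (1 - t * s) ^ 2) (-(2 * s * (1 - t * s))) t := fun t => by
    have := (((hasDerivAt_id t).mul_const s).const_sub 1).pow 2
    refine this.congr_deriv ?_
    simp
    ring
  constructor
  · have := le_of_hasDerivAt_nonneg_unitInterval (F := fun t => φ t / (1 - t * s) ^ 2)
      (F' := fun t => (φ' t * (1 - t * s) ^ 2 - φ t * -(2 * s * (1 - t * s))) /
        ((1 - t * s) ^ 2) ^ 2)
      (fun t ht => (hφ t ht).fun_div (hd t) (pow_pos (h1 t ht) 2).ne')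
      (fun t ht => by
        apply div_nonneg _ (by positivity)
        nlinarith [mul_le_mul_of_nonneg_left (hb t ht) (h1 t ht).le,
          mul_le_mul_of_nonneg_left (neg_abs_le (φ' t)) (pow_pos (h1 t ht) 2).le]) ht
    simp only [zero_mul, sub_zero, one_pow, div_one] at this
    rwa [le_div_iff₀ (pow_pos (h1 t ht) 2), mul_comm] at this
  · have := le_of_hasDerivAt_nonneg_unitInterval (F := fun t => -((1 - t * s) ^ 2 * φ t))
      (F' := fun t => -(-(2 * s * (1 - t * s)) * φ t + (1 - t * s) ^ 2 * φ' t))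
      (fun t ht => ((hd t).mul (hφ t ht)).neg)
      (fun t ht => by
        nlinarith [mul_le_mul_of_nonneg_left (hb t ht) (h1 t ht).le,
          mul_le_mul_of_nonneg_left (le_abs_self (φ' t)) (pow_pos (h1 t ht) 2).le]) ht
    simp only [zero_mul, sub_zero, one_pow, one_mul] at this
    linarith

section LineDerivatives

variable {E : Type*} [NormedAddCommGroup E] [NormedSpace ℝ E] {D : Set E} {f : E → ℝ}

theorem HasFDerivAt.hasDerivAt_line {F : Type*} [NormedAddCommGroup F] [NormedSpace ℝ F]
    {G : E → F} {G' : E →L[ℝ] F} {x u : E} {t : ℝ} (hG : HasFDerivAt G G' (x + t • u)) :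
    HasDerivAt (fun s : ℝ => G (x + s • u)) (G' u) t := by
  have h : HasDerivAt (fun s : ℝ => x + s • u) u t := by
    simpa using ((hasDerivAt_id t).smul_const u).const_add x
  exact hG.comp_hasDerivAt t h

theorem hasDerivAt_line_fderiv (hD : IsOpen D) (hf : ContDiffOn ℝ 3 f D) {x u : E} {t : ℝ}
    (hx : x + t • u ∈ D) :
    HasDerivAt (fun s : ℝ => f (x + s • u)) (fderiv ℝ f (x + t • u) u) t :=
  ((hf.contDiffAt (hD.mem_nhds hx)).differentiableAt (by norm_num)).hasFDerivAt.hasDerivAt_line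

theorem hasDerivAt_line_fderiv_fderiv (hD : IsOpen D) (hf : ContDiffOn ℝ 3 f D) {x u : E} {t : ℝ}
    (hx : x + t • u ∈ D) (v : E) :
    HasDerivAt (fun s : ℝ => fderiv ℝ f (x + s • u) v)
      (fderiv ℝ (fderiv ℝ f) (x + t • u) u v) t := by
  have h : ContDiffAt ℝ 2 (fderiv ℝ f) (x + t • u) :=
    (hf.contDiffAt (hD.mem_nhds hx)).fderiv_right (by norm_num)
  exact ((ContinuousLinearMap.apply ℝ ℝ v).hasFDerivAt.comp _
    (h.differentiableAt (by norm_num)).hasFDerivAt).hasDerivAt_line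

theorem hasDerivAt_line_fderiv_fderiv_fderiv (hD : IsOpen D) (hf : ContDiffOn ℝ 3 f D) {x u : E}
    {t : ℝ} (hx : x + t • u ∈ D) (v w : E) :
    HasDerivAt (fun s : ℝ => fderiv ℝ (fderiv ℝ f) (x + s • u) v w)
      (fderiv ℝ (fderiv ℝ (fderiv ℝ f)) (x + t • u) u v w) t := by
  have h : ContDiffAt ℝ 2 (fderiv ℝ f) (x + t • u) :=
    (hf.contDiffAt (hD.mem_nhds hx)).fderiv_right (by norm_num)
  have h' : ContDiffAt ℝ 1 (fderiv ℝ (fderiv ℝ f)) (x + t • u) := h.fderiv_right (by norm_num)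
  exact ((ContinuousLinearMap.apply ℝ ℝ w).hasFDerivAt.comp _
    ((ContinuousLinearMap.apply ℝ (E →L[ℝ] ℝ) v).hasFDerivAt.comp _
      (h'.differentiableAt (by norm_num)).hasFDerivAt)).hasDerivAt_line

theorem fderiv_fderiv_symm (hD : IsOpen D) (hf : ContDiffOn ℝ 3 f D) {x : E} (hx : x ∈ D)
    (u v : E) : fderiv ℝ (fderiv ℝ f) x u v = fderiv ℝ (fderiv ℝ f) x v u :=
  ((hf.contDiffAt (hD.mem_nhds hx)).isSymmSndFDerivAt (by simp; norm_num)) u v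

theorem eventually_line_mem (hD : IsOpen D) {x u : E} {t : ℝ} (hx : x + t • u ∈ D) :
    ∀ᶠ s in 𝓝 t, x + s • u ∈ D :=
  (Continuous.tendsto (f := fun s : ℝ => x + s • u) (by fun_prop) t).eventually (hD.mem_nhds hx)

theorem fderiv_fderiv_fderiv_symm_left (hD : IsOpen D) (hf : ContDiffOn ℝ 3 f D) {x : E}
    (hx : x ∈ D) (u v w : E) : fderiv ℝ (fderiv ℝ (fderiv ℝ f)) x u v w =
      fderiv ℝ (fderiv ℝ (fderiv ℝ f)) x v u w := by
  have h : ContDiffAt ℝ 2 (fderiv ℝ f) x :=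
    (hf.contDiffAt (hD.mem_nhds hx)).fderiv_right (by norm_num)
  rw [h.isSymmSndFDerivAt (by simp) u v]

theorem fderiv_fderiv_fderiv_symm_right (hD : IsOpen D) (hf : ContDiffOn ℝ 3 f D) {x : E}
    (hx : x ∈ D) (u v w : E) : fderiv ℝ (fderiv ℝ (fderiv ℝ f)) x u v w =
      fderiv ℝ (fderiv ℝ (fderiv ℝ f)) x u w v := by
  have hx' : x + (0 : ℝ) • u ∈ D := by simpa using hx
  have h1 := hasDerivAt_line_fderiv_fderiv_fderiv hD hf hx' v w
  have h2 := hasDerivAt_line_fderiv_fderiv_fderiv hD hf hx' w v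
  have := h1.unique (h2.congr_of_eventuallyEq
    ((eventually_line_mem hD hx').mono fun s hs => fderiv_fderiv_symm hD hf hs v w))
  simpa using this

theorem iteratedDeriv_two_line (hD : IsOpen D) (hf : ContDiffOn ℝ 3 f D) {x u : E} {t : ℝ}
    (hx : x + t • u ∈ D) :
    iteratedDeriv 2 (fun s : ℝ => f (x + s • u)) t = fderiv ℝ (fderiv ℝ f) (x + t • u) u u := by
  rw [iteratedDeriv_succ, iteratedDeriv_one]
  refine HasDerivAt.deriv ((hasDerivAt_line_fderiv_fderiv hD hf hx u).congr_of_eventuallyEq ?_)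
  exact (eventually_line_mem hD hx).mono fun s hs => (hasDerivAt_line_fderiv hD hf hs).deriv

theorem iteratedDeriv_three_line (hD : IsOpen D) (hf : ContDiffOn ℝ 3 f D) {x u : E} {t : ℝ}
    (hx : x + t • u ∈ D) :
    iteratedDeriv 3 (fun s : ℝ => f (x + s • u)) t =
      fderiv ℝ (fderiv ℝ (fderiv ℝ f)) (x + t • u) u u u := by
  rw [iteratedDeriv_succ]
  refine HasDerivAt.deriv
    ((hasDerivAt_line_fderiv_fderiv_fderiv hD hf hx u u).congr_of_eventuallyEq ?_)
  exact (eventually_line_mem hD hx).mono fun s hs => iteratedDeriv_two_line hD hf hs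

theorem fderiv_fderiv_nonneg_of_convexOn (hD : IsOpen D) (hf : ContDiffOn ℝ 3 f D)
    (hc : ConvexOn ℝ D f) {x : E} (hx : x ∈ D) (u : E) : 0 ≤ fderiv ℝ (fderiv ℝ f) x u u := by
  have hS : IsOpen {s : ℝ | x + s • u ∈ D} := hD.preimage (by fun_prop)
  have hx' : x + (0 : ℝ) • u ∈ D := by simpa using hx
  have hconv : ConvexOn ℝ {s : ℝ | x + s • u ∈ D} (fun s => f (x + s • u)) := by
    have := hc.comp_affineMap (AffineMap.lineMap x (x + u) : ℝ →ᵃ[ℝ] E)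
    have e : ∀ s : ℝ, AffineMap.lineMap x (x + u) s = x + s • u := fun s => by
      simp [AffineMap.lineMap_apply, add_comm]
    simpa only [Function.comp_def, Set.preimage, e] using this
  have hm : MonotoneOn (fun s : ℝ => fderiv ℝ f (x + s • u) u) {s : ℝ | x + s • u ∈ D} :=
    (hconv.monotoneOn_deriv fun s hs =>
      (hasDerivAt_line_fderiv hD hf hs).differentiableAt).congr fun s hs =>
        (hasDerivAt_line_fderiv hD hf hs).deriv
  have := hm.derivWithin_nonneg (x := 0)
  rw [derivWithin_of_isOpen hS hx', (hasDerivAt_line_fderiv_fderiv hD hf hx' u).deriv] at this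
  simpa using this

/-- The diagonal self-concordance inequality bounds the whole third derivative. -/
theorem abs_fderiv_fderiv_fderiv_le (hD : IsOpen D) (hf : ContDiffOn ℝ 3 f D)
    (hc : ConvexOn ℝ D f) {x : E} (hx : x ∈ D)
    (hsc : ∀ u, |fderiv ℝ (fderiv ℝ (fderiv ℝ f)) x u u u| ≤
      2 * fderiv ℝ (fderiv ℝ f) x u u ^ ((3 : ℝ) / 2)) (h v : E) :
    |fderiv ℝ (fderiv ℝ (fderiv ℝ f)) x h v v| ≤
      2 * (fderiv ℝ (fderiv ℝ f) x v v * √(fderiv ℝ (fderiv ℝ f) x h h)) := by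
  have hq : ∀ a b : ℝ, fderiv ℝ (fderiv ℝ f) x (a • v + b • h) (a • v + b • h) =
      fderiv ℝ (fderiv ℝ f) x v v * a ^ 2 + 2 * fderiv ℝ (fderiv ℝ f) x v h * a * b
        + fderiv ℝ (fderiv ℝ f) x h h * b ^ 2 := fun a b => by
    simp only [map_add, map_smul, _root_.add_apply, _root_.smul_apply, smul_eq_mul,
      fderiv_fderiv_symm hD hf hx h v]
    ring
  refine abs_le_of_abs_cubic_le_posSemidef (A := fderiv ℝ (fderiv ℝ (fderiv ℝ f)) x v v v)
    (C := fderiv ℝ (fderiv ℝ (fderiv ℝ f)) x h h v)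
    (D := fderiv ℝ (fderiv ℝ (fderiv ℝ f)) x h h h)
    (b := fderiv ℝ (fderiv ℝ f) x v h) zero_le_two (fun a b => ?_) (fun a b => ?_)
  · rw [← hq]
    exact fderiv_fderiv_nonneg_of_convexOn hD hf hc hx _
  · rw [← hq]
    refine le_of_eq_of_le (congrArg _ ?_) (hsc (a • v + b • h))
    simp only [map_add, map_smul, _root_.add_apply, _root_.smul_apply, smul_eq_mul,
      fderiv_fderiv_fderiv_symm_left hD hf hx v h, fderiv_fderiv_fderiv_symm_right hD hf hx h v h,
      fderiv_fderiv_fderiv_symm_right hD hf hx v v h]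
    ring

theorem hessian_segment_bounds (hD : IsOpen D) (hf : ContDiffOn ℝ 3 f D) (hc : ConvexOn ℝ D f)
    (hsc : ∀ x ∈ D, ∀ u, |fderiv ℝ (fderiv ℝ (fderiv ℝ f)) x u u u| ≤
      2 * fderiv ℝ (fderiv ℝ f) x u u ^ ((3 : ℝ) / 2))
    {x h : E} (hx : x ∈ D) (hxh : x + h ∈ D) {s : ℝ} (hs : s = √(fderiv ℝ (fderiv ℝ f) x h h))
    (hs1 : s < 1) (v : E) {t : ℝ} (ht : t ∈ Icc (0 : ℝ) 1) :
    (1 - t * s) ^ 2 * fderiv ℝ (fderiv ℝ f) x v v ≤ fderiv ℝ (fderiv ℝ f) (x + t • h) v v ∧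
      (1 - t * s) ^ 2 * fderiv ℝ (fderiv ℝ f) (x + t • h) v v ≤ fderiv ℝ (fderiv ℝ f) x v v := by
  have hmem : ∀ t ∈ Icc (0 : ℝ) 1, x + t • h ∈ D := fun t ht => hc.1.add_smul_mem hx hxh ht
  have hpos : ∀ v, ∀ t ∈ Icc (0 : ℝ) 1, 0 ≤ fderiv ℝ (fderiv ℝ f) (x + t • h) v v :=
    fun v t ht => fderiv_fderiv_nonneg_of_convexOn hD hf hc (hmem t ht) v
  have hρ : ∀ t ∈ Icc (0 : ℝ) 1,
      (1 - t * s) * √(fderiv ℝ (fderiv ℝ f) (x + t • h) h h) ≤ s := fun t ht => by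
    have := sqrt_le_of_abs_deriv_le_rpow
      (fun t ht => hasDerivAt_line_fderiv_fderiv_fderiv hD hf (hmem t ht) h h) (hpos h)
      (fun t ht => hsc _ (hmem t ht) h) ht
    simpa [← hs] using this
  have := bounds_of_abs_deriv_le_mul (hs ▸ Real.sqrt_nonneg _) hs1
    (fun t ht => hasDerivAt_line_fderiv_fderiv_fderiv hD hf (hmem t ht) v v) (hpos v) hρ
    (fun t ht => abs_fderiv_fderiv_fderiv_le hD hf hc (hmem t ht) (hsc _ (hmem t ht)) h v) ht
  simpa using this

theorem abs_hessian_sub_le (hD : IsOpen D) (hf : ContDiffOn ℝ 3 f D) (hc : ConvexOn ℝ D f)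
    (hsc : ∀ x ∈ D, ∀ u, |fderiv ℝ (fderiv ℝ (fderiv ℝ f)) x u u u| ≤
      2 * fderiv ℝ (fderiv ℝ f) x u u ^ ((3 : ℝ) / 2))
    {x h : E} (hx : x ∈ D) (hxh : x + h ∈ D) {s : ℝ} (hs : s = √(fderiv ℝ (fderiv ℝ f) x h h))
    (hs1 : s < 1) (u v : E) {t : ℝ} (ht : t ∈ Icc (0 : ℝ) 1) :
    |fderiv ℝ (fderiv ℝ f) (x + t • h) u v - fderiv ℝ (fderiv ℝ f) x u v| ≤
      (1 / (1 - t * s) ^ 2 - 1) *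
        (√(fderiv ℝ (fderiv ℝ f) x u u) * √(fderiv ℝ (fderiv ℝ f) x v v)) := by
  have hs0 : 0 ≤ s := hs ▸ Real.sqrt_nonneg _
  have h1 : 0 < 1 - t * s := by nlinarith [ht.1, ht.2]
  have h2 : 1 - t * s ≤ 1 := by nlinarith [ht.1, ht.2]
  have h3 : (1 - t * s) ^ 2 ≤ 1 := pow_le_one₀ h1.le h2
  have hxt := hc.1.add_smul_mem hx hxh ht
  refine abs_bilin_le_of_abs_quad_le
    (A := fderiv ℝ (fderiv ℝ f) (x + t • h) - fderiv ℝ (fderiv ℝ f) x)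
    (B := fderiv ℝ (fderiv ℝ f) x) (fun u v => ?_)
    (fderiv_fderiv_symm hD hf hx) ?_ (fderiv_fderiv_nonneg_of_convexOn hD hf hc hx)
    (fun v => ?_) u v
  · simp only [_root_.sub_apply]
    rw [fderiv_fderiv_symm hD hf hx, fderiv_fderiv_symm hD hf hxt]
  · rw [sub_nonneg]
    exact one_le_one_div (by positivity) h3
  · obtain ⟨hl, hu⟩ := hessian_segment_bounds hD hf hc hsc hx hxh hs hs1 v ht
    have h0 := fderiv_fderiv_nonneg_of_convexOn hD hf hc hx v
    rw [mul_comm ((1 - t * s) ^ 2), ← le_div_iff₀ (by positivity), div_eq_mul_one_div] at hu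
    simp only [_root_.sub_apply]
    have h4 : 1 - (1 - t * s) ^ 2 ≤ 1 / (1 - t * s) ^ 2 - 1 := by
      have : (1 - t * s) ^ 2 * (1 / (1 - t * s) ^ 2) = 1 := by field_simp
      have h5 : 1 ≤ 1 / (1 - t * s) ^ 2 := one_le_one_div (by positivity) h3
      nlinarith
    rw [abs_le]
    constructor <;> nlinarith [mul_le_mul_of_nonneg_right h4 h0]

theorem abs_fderiv_sub_sub_hessian_le (hD : IsOpen D) (hf : ContDiffOn ℝ 3 f D)
    (hc : ConvexOn ℝ D f)
    (hsc : ∀ x ∈ D, ∀ u, |fderiv ℝ (fderiv ℝ (fderiv ℝ f)) x u u u| ≤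
      2 * fderiv ℝ (fderiv ℝ f) x u u ^ ((3 : ℝ) / 2))
    {x h : E} (hx : x ∈ D) (hxh : x + h ∈ D) {s : ℝ} (hs : s = √(fderiv ℝ (fderiv ℝ f) x h h))
    (hs1 : s < 1) (v : E) :
    |fderiv ℝ f (x + h) v - fderiv ℝ f x v - fderiv ℝ (fderiv ℝ f) x h v| ≤
      s ^ 2 / (1 - s) * √(fderiv ℝ (fderiv ℝ f) x v v) := by
  have hs0 : 0 ≤ s := hs ▸ Real.sqrt_nonneg _
  have h1 : ∀ t ∈ Icc (0 : ℝ) 1, 0 < 1 - t * s := fun t ht => by nlinarith [ht.1, ht.2]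
  set κ := √(fderiv ℝ (fderiv ℝ f) x v v) with hκ
  have hB : ∀ t ∈ Icc (0 : ℝ) 1, HasDerivAt (fun t => ((1 - t * s)⁻¹ - t * s) * κ)
      ((1 / (1 - t * s) ^ 2 - 1) * (s * κ)) t := fun t ht => by
    have := ((((hasDerivAt_id t).mul_const s).const_sub 1).fun_inv (h1 t ht).ne').sub
      ((hasDerivAt_id t).mul_const s)
    refine (this.mul_const κ).congr_deriv ?_
    simp
    ring
  have hG : ∀ t ∈ Icc (0 : ℝ) 1,
      HasDerivAt (fun t : ℝ => fderiv ℝ f (x + t • h) v - t * fderiv ℝ (fderiv ℝ f) x h v)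
      (fderiv ℝ (fderiv ℝ f) (x + t • h) h v - fderiv ℝ (fderiv ℝ f) x h v) t := fun t ht => by
    have := (hasDerivAt_line_fderiv_fderiv hD hf (hc.1.add_smul_mem hx hxh ht) v).fun_sub
      ((hasDerivAt_id t).mul_const (fderiv ℝ (fderiv ℝ f) x h v))
    simpa using this
  have hb := fun t (ht : t ∈ Icc (0 : ℝ) 1) =>
    abs_le.1 (abs_hessian_sub_le hD hf hc hsc hx hxh hs hs1 h v ht)
  rw [← hs, ← hκ] at hb
  have e : s ^ 2 / (1 - s) = (1 - s)⁻¹ - s - 1 := by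
    have : 1 - s ≠ 0 := by linarith
    field_simp
    ring
  have hu := le_of_hasDerivAt_nonneg_unitInterval (fun t ht => (hB t ht).sub (hG t ht))
    (fun t ht => by linarith [hb t ht]) (right_mem_Icc.2 zero_le_one)
  have hl := le_of_hasDerivAt_nonneg_unitInterval (fun t ht => (hB t ht).add (hG t ht))
    (fun t ht => by linarith [hb t ht]) (right_mem_Icc.2 zero_le_one)
  simp at hu hl
  rw [e, abs_le]
  constructor <;> linarith

theorem decrement_le_of_variational (hD : IsOpen D) (hf : ContDiffOn ℝ 3 f D)
    (hc : ConvexOn ℝ D f)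
    (hsc : ∀ x ∈ D, ∀ u, |fderiv ℝ (fderiv ℝ (fderiv ℝ f)) x u u u| ≤
      2 * fderiv ℝ (fderiv ℝ f) x u u ^ ((3 : ℝ) / 2))
    {x d e : E} {α l : ℝ} (hα0 : 0 < α) (hα1 : α ≤ 1) (hx : x ∈ D) (hxd : x + α • d ∈ D)
    (hl : l = √(fderiv ℝ (fderiv ℝ f) x d d)) (hcond : α * l < 1 - 1 / √2)
    (hvar : 0 ≤ fderiv ℝ (fderiv ℝ f) x d (e - (1 - α) • d) + fderiv ℝ f x (e - (1 - α) • d)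
      - fderiv ℝ (fderiv ℝ f) (x + α • d) e (e - (1 - α) • d)
      - fderiv ℝ f (x + α • d) (e - (1 - α) • d)) :
    √(fderiv ℝ (fderiv ℝ f) (x + α • d) e e) ≤
      (1 - α + (2 * α ^ 2 - α) * l) / (1 - 4 * α * l + 2 * α ^ 2 * l ^ 2) * l := by
  have hl0 : 0 ≤ l := hl ▸ Real.sqrt_nonneg _
  have hpos := fderiv_fderiv_nonneg_of_convexOn hD hf hc hx
  have hsym := fderiv_fderiv_symm hD hf hx
  set s := α * l with hs
  have hs0 : 0 ≤ s := by positivity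
  have hs' : s = √(fderiv ℝ (fderiv ℝ f) x (α • d) (α • d)) := by
    simp only [map_smul, _root_.smul_apply, smul_eq_mul]
    rw [← mul_assoc, ← sq,
      Real.sqrt_mul (sq_nonneg α), Real.sqrt_sq hα0.le, ← hl]
  have h2 : (1 / √2) ^ 2 = 1 / 2 := by rw [div_pow, Real.sq_sqrt zero_le_two, one_pow]
  have h3 : 0 < 1 / √2 := by positivity
  have hs1 : s < 1 := by linarith
  have hden : 0 < 2 * (1 - s) ^ 2 - 1 := by nlinarith
  set H := fderiv ℝ (fderiv ℝ f) x with hH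
  set w := e - (1 - α) • d with hw
  have hone : (1 : ℝ) ∈ Icc (0 : ℝ) 1 := right_mem_Icc.2 zero_le_one
  have hHd := abs_hessian_sub_le hD hf hc hsc hx hxd hs' hs1 e w hone
  have hGd := abs_fderiv_sub_sub_hessian_le hD hf hc hsc hx hxd hs' hs1 w
  have hee := (hessian_segment_bounds hD hf hc hsc hx hxd hs' hs1 e hone).2
  have hcs : |H w d| ≤ √(H w w) * l := by
    have := abs_bilin_le_of_abs_quad_le hsym hsym zero_le_one hpos
      (fun v => by rw [one_mul, abs_of_nonneg (hpos v)]) w d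
    rwa [one_mul, ← hl] at this
  simp only [one_smul, one_mul, ← hH, map_smul, _root_.smul_apply, smul_eq_mul] at hHd hGd hee
  generalize hW : √(H w w) = W at *
  generalize hm : √(H e e) = m at *
  have hW0 : 0 ≤ W := hW ▸ Real.sqrt_nonneg _
  have hm0 : 0 ≤ m := hm ▸ Real.sqrt_nonneg _
  have hWW : H w w = W ^ 2 := by rw [← hW, Real.sq_sqrt (hpos w)]
  have hmm : H e e = m ^ 2 := by rw [← hm, Real.sq_sqrt (hpos e)]
  have hdd : H d d = l ^ 2 := by rw [hl, Real.sq_sqrt (hpos d)]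
  have hHew : H e w = H w w + (1 - α) * H d w := by
    rw [← smul_eq_mul, ← _root_.smul_apply, ← map_smul, ← _root_.add_apply, ← map_add, hw,
      sub_add_cancel]
  -- the distance between consecutive directions, in the metric at `x`
  have hWle : W ≤ s ^ 2 / (1 - s) + (1 / (1 - s) ^ 2 - 1) * m := by
    have hprod : W ^ 2 ≤ (s ^ 2 / (1 - s) + (1 / (1 - s) ^ 2 - 1) * m) * W := by
      have a1 := (abs_le.1 hHd).1
      have a2 := (abs_le.1 hGd).1
      nlinarith
    rcases hW0.eq_or_lt with h | h
    · rw [← h]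
      have : (1 - s) ^ 2 ≤ 1 := pow_le_one₀ (by linarith) (by linarith)
      have : 1 ≤ 1 / (1 - s) ^ 2 := one_le_one_div (pow_pos (by linarith) 2) this
      exact add_nonneg (div_nonneg (sq_nonneg s) (by linarith)) (mul_nonneg (by linarith) hm0)
    · rw [sq] at hprod
      exact le_of_mul_le_mul_right hprod h
  have hmle : m ≤ W + (1 - α) * l := by
    have hexp : H e e = H w w + 2 * (1 - α) * H w d + (1 - α) ^ 2 * H d d := by
      have he : e = w + (1 - α) • d := by rw [hw, sub_add_cancel]
      conv_lhs => rw [he]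
      simp only [map_add, map_smul, _root_.add_apply, _root_.smul_apply, smul_eq_mul, hsym d w]
      ring
    refine (sq_le_sq₀ hm0 (add_nonneg hW0 (mul_nonneg (by linarith) hl0))).1 ?_
    rw [← hmm, hexp, hWW, hdd]
    nlinarith [mul_le_mul_of_nonneg_left (abs_le.1 hcs).2 (by linarith : 0 ≤ 1 - α)]
  have hfin : (2 * (1 - s) ^ 2 - 1) * m ≤ ((1 - α) * (1 - s) + α * s) * (1 - s) * l := by
    have h1s : 0 < 1 - s := by linarith
    have := mul_le_mul_of_nonneg_left (hmle.trans (add_le_add_left hWle _)) (sq_nonneg (1 - s))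
    have e1 : (1 - s) ^ 2 * (s ^ 2 / (1 - s) + (1 / (1 - s) ^ 2 - 1) * m + (1 - α) * l)
        = (1 - s) * s ^ 2 + (1 - (1 - s) ^ 2) * m + (1 - s) ^ 2 * ((1 - α) * l) := by
      field_simp
    rw [e1] at this
    have e2 : s ^ 2 = s * (α * l) := by rw [hs]; ring
    rw [e2] at this
    linarith
  have hdec : √(fderiv ℝ (fderiv ℝ f) (x + α • d) e e) * (1 - s) ≤ m := by
    rw [← hm, ← Real.sqrt_sq (by linarith : 0 ≤ 1 - s), ← Real.sqrt_mul
      (fderiv_fderiv_nonneg_of_convexOn hD hf hc hxd e)]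
    apply Real.sqrt_le_sqrt
    linarith
  have hd : 1 - 4 * α * l + 2 * α ^ 2 * l ^ 2 = 2 * (1 - s) ^ 2 - 1 := by rw [hs]; ring
  rw [hd, div_mul_eq_mul_div, le_div_iff₀ hden]
  refine le_of_mul_le_mul_right (a := 1 - s) ?_ (by linarith)
  calc _ = (2 * (1 - s) ^ 2 - 1) * (√(fderiv ℝ (fderiv ℝ f) (x + α • d) e e) * (1 - s)) := by ring
    _ ≤ (2 * (1 - s) ^ 2 - 1) * m := by gcongr
    _ ≤ _ := hfin
    _ = _ := by rw [hs]; ring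

end LineDerivatives

theorem IsProxPt.le_add_dotProduct {H : Matrix (Fin n) (Fin n) ℝ}
    (hH : ∀ u v, u ⬝ᵥ H *ᵥ v = v ⬝ᵥ H *ᵥ u) {g : (Fin n → ℝ) → EReal} (hg : EConvex g)
    {u p q : Fin n → ℝ} (hp : IsProxPt H g u p) {γp γq : ℝ} (hγp : g p = γp) (hγq : g q = γq) :
    γp ≤ γq + (H *ᵥ p - u) ⬝ᵥ (q - p) := by
  have hstep : ∀ t : ℝ, 0 < t → t ≤ 1 →
      γp - γq - (H *ᵥ p - u) ⬝ᵥ (q - p) ≤ t * (1 / 2 * ((q - p) ⬝ᵥ H *ᵥ (q - p))) := by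
    intro t ht0 ht1
    have h1 := hp ((1 - t) • p + t • q)
    have h2 := hg p q (1 - t) t (by linarith) ht0.le (by ring)
    rw [hγp, hγq] at h2
    simp only [proxObj, hγp] at h1
    have h3 := h1.trans (add_le_add_left h2 _)
    norm_cast at h3
    have e : (1 - t) • p + t • q = p + t • (q - p) := by module
    rw [e] at h3
    generalize q - p = r at h3 ⊢
    have hr := hH r p
    have hr' := dotProduct_comm r (H *ᵥ p)
    simp only [mulVec_add, mulVec_smul, add_dotProduct, dotProduct_add, smul_dotProduct,
      dotProduct_smul, smul_eq_mul, sub_dotProduct] at h3 ⊢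
    rw [← hr, hr'] at h3
    refine le_of_mul_le_mul_left ?_ ht0
    linarith
  have hl : Tendsto (fun t : ℝ => t * (1 / 2 * ((q - p) ⬝ᵥ H *ᵥ (q - p)))) (𝓝[>] 0)
      (𝓝 (0 * (1 / 2 * ((q - p) ⬝ᵥ H *ᵥ (q - p))))) :=
    (Continuous.tendsto (by fun_prop) 0).mono_left nhdsWithin_le_nhds
  have := ge_of_tendsto hl (eventually_of_mem (Ioc_mem_nhdsGT zero_lt_one)
    fun t ht => hstep t ht.1 ht.2)
  linarith

theorem IsProxPt.ne_top {H : Matrix (Fin n) (Fin n) ℝ} {g : (Fin n → ℝ) → EReal}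
    {u p x : Fin n → ℝ} (hp : IsProxPt H g u p) (hx : g x ≠ ⊤) : g p ≠ ⊤ := by
  intro h
  have := hp x
  rw [proxObj, proxObj, h, EReal.top_add_coe, top_le_iff] at this
  exact (EReal.add_lt_top hx (EReal.coe_ne_top _)).ne this

@[simp] theorem dotCLM_apply (v y : Fin n → ℝ) : dotCLM v y = v ⬝ᵥ y := rfl

theorem fderiv_fderiv_apply_eq_dotProduct {D : Set (Fin n → ℝ)} {f : (Fin n → ℝ) → ℝ}
    {f' : (Fin n → ℝ) → Fin n → ℝ} {f'' : (Fin n → ℝ) → Matrix (Fin n) (Fin n) ℝ}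
    (hD : IsOpen D) (hf : ContDiffOn ℝ 3 f D)
    (hgrad : ∀ x ∈ D, HasFDerivAt f (dotCLM (f' x)) x)
    (hhess : ∀ x ∈ D,
      HasFDerivAt f' (LinearMap.toContinuousLinearMap (f'' x).mulVecLin) x)
    {x : Fin n → ℝ} (hx : x ∈ D) (u v : Fin n → ℝ) :
    fderiv ℝ (fderiv ℝ f) x u v = v ⬝ᵥ f'' x *ᵥ u := by
  have hx' : x + (0 : ℝ) • u ∈ D := by simpa using hx
  have h1 := hasDerivAt_line_fderiv_fderiv hD hf hx' v
  have h2 : HasDerivAt (fun s : ℝ => v ⬝ᵥ f' (x + s • u)) (v ⬝ᵥ f'' (x + (0 : ℝ) • u) *ᵥ u) 0 :=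
    ((dotCLM v).hasFDerivAt.comp _ (hhess _ hx')).hasDerivAt_line
  have := h1.unique (h2.congr_of_eventuallyEq ((eventually_line_mem hD hx').mono fun s hs => by
    simp only [(hgrad _ hs).fderiv, dotCLM_apply, dotProduct_comm]))
  simpa using this

/-- One step of the proximal-Newton scheme with step size `α_k ∈ (0,1]`
satisfying `α_k λ_k < 1 − 1/√2` yields
`λ_{k+1} ≤ ((1 − α_k + (2α_k² − α_k)λ_k)/(1 − 4α_kλ_k + 2α_k²λ_k²)) λ_k`. -/
theorem proximal_newton_decrement_recursion
    (n : ℕ) (D : Set (Fin n → ℝ)) (f : (Fin n → ℝ) → ℝ)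
    (f' : (Fin n → ℝ) → Fin n → ℝ)
    (f'' : (Fin n → ℝ) → Matrix (Fin n) (Fin n) ℝ)
    (hf : StdSelfConcordantOn D f)
    (hgrad : ∀ x ∈ D, HasFDerivAt f (dotCLM (f' x)) x)
    (hhess : ∀ x ∈ D,
      HasFDerivAt f' (LinearMap.toContinuousLinearMap (f'' x).mulVecLin) x)
    (g : (Fin n → ℝ) → EReal) (hg_proper : EProper g)
    (hg_lsc : LowerSemicontinuous g) (hg_conv : EConvex g)
    (xs : Fin n → ℝ) (hxsD : xs ∈ D) (hxsg : g xs ≠ ⊤)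
    (hxs_min : ∀ y, Fext D f g xs ≤ Fext D f g y)
    (hxs_uniq : ∀ y, (∀ z, Fext D f g y ≤ Fext D f g z) → y = xs)
    (hxs_pd : (f'' xs).PosDef)
    (xk : Fin n → ℝ) (hxkD : xk ∈ D) (hxkg : g xk ≠ ⊤) (hpdk : (f'' xk).PosDef)
    (dk : Fin n → ℝ)
    (hdk : IsProxPt (f'' xk) g ((f'' xk).mulVec xk - f' xk) (xk + dk))
    (lamk : ℝ) (hlamk : lamk = mNorm (f'' xk) dk)
    (alp : ℝ) (halp0 : 0 < alp) (halp1 : alp ≤ 1)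
    (xk1 : Fin n → ℝ) (hupd : xk1 = xk + alp • dk)
    (hxk1D : xk1 ∈ D) (hxk1g : g xk1 ≠ ⊤) (hpdk1 : (f'' xk1).PosDef)
    (dk1 : Fin n → ℝ)
    (hdk1 : IsProxPt (f'' xk1) g ((f'' xk1).mulVec xk1 - f' xk1) (xk1 + dk1))
    (lamk1 : ℝ) (hlamk1 : lamk1 = mNorm (f'' xk1) dk1)
    (hcond : alp * lamk < 1 - 1 / Real.sqrt 2) :
    lamk1 ≤
      (1 - alp + (2 * alp ^ 2 - alp) * lamk) /
          (1 - 4 * alp * lamk + 2 * alp ^ 2 * lamk ^ 2) * lamk := by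
  obtain ⟨hD, -, hc, hf3, hsc⟩ := hf
  have hF1 : ∀ x ∈ D, ∀ v, fderiv ℝ f x v = f' x ⬝ᵥ v := fun x hx v => by
    rw [(hgrad x hx).fderiv, dotCLM_apply]
  have hF2 : ∀ x ∈ D, ∀ u v, fderiv ℝ (fderiv ℝ f) x u v = v ⬝ᵥ f'' x *ᵥ u := fun x hx =>
    fderiv_fderiv_apply_eq_dotProduct hD hf3 hgrad hhess hx
  have hsymm : ∀ x ∈ D, ∀ u v, u ⬝ᵥ f'' x *ᵥ v = v ⬝ᵥ f'' x *ᵥ u := fun x hx u v => by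
    rw [← hF2 x hx, ← hF2 x hx, fderiv_fderiv_symm hD hf3 hx]
  have hsc' : ∀ x ∈ D, ∀ u, |fderiv ℝ (fderiv ℝ (fderiv ℝ f)) x u u u| ≤
      2 * fderiv ℝ (fderiv ℝ f) x u u ^ ((3 : ℝ) / 2) := fun x hx u => by
    have hx' : x + (0 : ℝ) • u ∈ D := by simpa using hx
    have := hsc x hx u 0 hx'
    rw [iteratedDeriv_three_line hD hf3 hx', iteratedDeriv_two_line hD hf3 hx'] at this
    simpa using this
  subst hupd
  set γp := (g (xk + dk)).toReal
  set γq := (g (xk + alp • dk + dk1)).toReal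
  have hγp : g (xk + dk) = γp := (EReal.coe_toReal (hdk.ne_top hxkg) (hg_proper.1 _)).symm
  have hγq : g (xk + alp • dk + dk1) = γq :=
    (EReal.coe_toReal (hdk1.ne_top hxkg) (hg_proper.1 _)).symm
  have hvar1 := hdk.le_add_dotProduct (hsymm xk hxkD) hg_conv hγp hγq
  have hvar2 := hdk1.le_add_dotProduct (hsymm _ hxk1D) hg_conv hγq hγp
  have e1 : xk + alp • dk + dk1 - (xk + dk) = dk1 - (1 - alp) • dk := by module
  have e2 : xk + dk - (xk + alp • dk + dk1) = -(dk1 - (1 - alp) • dk) := by module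
  rw [e1, mulVec_add, add_sub_sub_cancel, add_dotProduct] at hvar1
  rw [e2, mulVec_add, add_sub_sub_cancel, add_dotProduct, dotProduct_neg, dotProduct_neg] at hvar2
  rw [hlamk1, mNorm, ← hF2 _ hxk1D]
  refine decrement_le_of_variational hD hf3 hc hsc' halp0 halp1 hxkD hxk1D
    (by rw [hlamk, mNorm, hF2 _ hxkD]) hcond ?_
  rw [hF1 _ hxkD, hF1 _ hxk1D, hF2 _ hxkD, hF2 _ hxk1D, dotProduct_comm _ (f'' xk *ᵥ dk),
    dotProduct_comm _ (f'' _ *ᵥ dk1)]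
  linarith
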